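/- arXiv:1511.03381 — 2 statements merged into one kernel-verified Lean document; each statement's English description precedes it below -/
import Mathlib

section
/- Let d ≥ 3. There exists a constant c̄_d > 0 depending only on d such that for all continuous g_1, …, g_{d-1} : S^{d-1} → ℝ and all ξ ∈ S^{d-1}: Q(g_1, …, g_{d-1})(ξ) = c̄_d Σ_{σ_1, σ_2 ∈ S_d} sign(σ_1) sign(σ_2) ξ_{σ_1(d)} ξ_{σ_2(d)} ∏_{k=1}^{d-1} R( x ↦ x_{σ_1(k)} x_{σ_2(k)} g_k(x) )(ξ), where S_d is the set of permutations of {1, …, d} and x_j denotes the j-th coordinate of x ∈ ℝ^d. -/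
open MeasureTheory Metric Filter Topology
open scoped Pointwise ENNReal

noncomputable section

abbrev Ed (d : ℕ) := EuclideanSpace ℝ (Fin d)

def sphereSet (d : ℕ) : Set (Ed d) := Metric.sphere 0 1

/-- The surface measure on the unit sphere `S^{d-1} ⊆ ℝ^d`, realized as the
`(d-1)`-dimensional Hausdorff measure restricted to the sphere. -/
def sphereMeasure (d : ℕ) : Measure (Ed d) := (μH[(d : ℝ) - 1]).restrict (sphereSet d)

/-- `L²` norm of a function on the sphere `S^{d-1}`. -/
def L2norm (d : ℕ) (f : Ed d → ℝ) : ℝ := Real.sqrt (∫ x, f x ^ 2 ∂ sphereMeasure d)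

/-- sup norm of a function on the sphere `S^{d-1}`. -/
def supNorm (d : ℕ) (f : Ed d → ℝ) : ℝ := sSup ((fun x => |f x|) '' sphereSet d)

/-- The set of admissible constants `M` in the definition of the norm `‖f‖_{U_a}`. -/
def UaSet (d : ℕ) (a : ℝ) (f : Ed d → ℝ) : Set ℝ :=
  {M | 0 < M ∧ BddAbove ((fun x => |f x|) '' sphereSet d) ∧ supNorm d f < M ∧
    ∀ n : ℕ, 0 < n → ∃ p : MvPolynomial (Fin d) ℝ, p.totalDegree ≤ n ∧
      L2norm d (fun x => f x - MvPolynomial.eval (fun i => x i) p) < M * (n : ℝ) ^ (-a)}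

/-- Membership in the class `U_a`. -/
def MemUa (d : ℕ) (a : ℝ) (f : Ed d → ℝ) : Prop := (UaSet d a f).Nonempty

/-- The norm `‖f‖_{U_a}`. -/
def UaNorm (d : ℕ) (a : ℝ) (f : Ed d → ℝ) : ℝ := sInf (UaSet d a f)

/-- The `(d-2)`-dimensional surface measure on the subsphere `S^{d-1} ∩ x^⊥`. -/
def subSphere (d : ℕ) (x : Ed d) : Measure (Ed d) :=
  (μH[(d : ℝ) - 2]).restrict (sphereSet d ∩ {y | (inner ℝ x y : ℝ) = 0})

/-- Iterated integral of a function of `n` variables with respect to a measure `μ`. -/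
def iterInt {α : Type*} [MeasurableSpace α] : (n : ℕ) → Measure α → ((Fin n → α) → ℝ) → ℝ
  | 0, _, F => F (fun i => i.elim0)
  | n + 1, μ, F => ∫ t, iterInt n μ (fun v => F (Fin.cons t v)) ∂μ

/-- For `x ∈ S^{d-1}` and `x_1, …, x_{d-1} ∈ x^⊥`, the determinant of `x_1, …, x_{d-1}`
with respect to an orthonormal basis of `x^⊥` coincides, up to sign, with the `d × d`
determinant of the vectors `x_1, …, x_{d-1}, x`; we use the latter. -/
def detCols (d : ℕ) (v : Fin (d - 1) → Ed d) (x : Ed d) : ℝ :=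
  Matrix.det (Matrix.of (fun (i j : Fin d) =>
    if h : (j : ℕ) < d - 1 then v ⟨(j : ℕ), h⟩ i else x i))

def QInt (d : ℕ) (g : Fin (d - 1) → Ed d → ℝ) (x : Ed d) : ℝ :=
  iterInt (d - 1) (subSphere d x) (fun v => detCols d v x ^ 2 * ∏ k, g k (v k))

/-- The normalizing constant `c_d`, chosen so that `Q(1, …, 1) = 1`. -/
def cQ (d : ℕ) : ℝ :=
  if h : 0 < d then (QInt d (fun _ _ => 1) (EuclideanSpace.single (⟨0, h⟩ : Fin d) 1))⁻¹ else 1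

/-- The transform `Q(g_1, …, g_{d-1})`. -/
def Qfun (d : ℕ) (g : Fin (d - 1) → Ed d → ℝ) (x : Ed d) : ℝ := cQ d * QInt d g x

/-- The total surface measure `|S^{n-1}|` of the unit sphere in `ℝ^n`. -/
def sphVol (n : ℕ) : ℝ := (μH[(n : ℝ) - 1] (Metric.sphere (0 : EuclideanSpace ℝ (Fin n)) 1)).toReal

/-- The normalized Radon transform, `R(1) = 1`. -/
def Radon (d : ℕ) (f : Ed d → ℝ) (x : Ed d) : ℝ :=
  (sphVol (d - 1))⁻¹ * ∫ y, f y ∂ subSphere d x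

def IsConvexBody (d : ℕ) (K : Set (Ed d)) : Prop :=
  Convex ℝ K ∧ IsCompact K ∧ (interior K).Nonempty

/-- Support function of a set. -/
def suppFn (d : ℕ) (K : Set (Ed d)) (u : Ed d) : ℝ := sSup ((fun y => (inner ℝ u y : ℝ)) '' K)

/-- Orthogonal projection onto the hyperplane `u^⊥` (for a unit vector `u`). -/
def projHyp (d : ℕ) (u : Ed d) (y : Ed d) : Ed d := y - (inner ℝ y u : ℝ) • u

/-- `P` is the projection body of `K`: its support function at a unit vector `u` is the
`(d-1)`-volume of the projection of `K` to `u^⊥`. -/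
def IsProjBody (d : ℕ) (K P : Set (Ed d)) : Prop :=
  IsConvexBody d P ∧
    ∀ u : Ed d, ‖u‖ = 1 → suppFn d P u = (μH[(d : ℝ) - 1] (projHyp d u '' K)).toReal

/-- `K` has absolutely continuous surface area measure with curvature function `f`:
the surface area measure of every Borel subset `ω` of the sphere (that is, the
`(d-1)`-dimensional Hausdorff measure of the set of boundary points of `K` having an outer
unit normal in `ω`) equals `∫_ω f`. -/
def HasCurvatureFn (d : ℕ) (K : Set (Ed d)) (f : Ed d → ℝ) : Prop :=
  ∀ ω : Set (Ed d), MeasurableSet ω → ω ⊆ sphereSet d →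
    μH[(d : ℝ) - 1] {x | x ∈ frontier K ∧
        ∃ u ∈ ω, ∀ y ∈ K, (inner ℝ u y : ℝ) ≤ (inner ℝ u x : ℝ)} =
      ENNReal.ofReal (∫ y in ω, f y ∂ sphereMeasure d)

/-- Banach–Mazur distance. -/
def bmDist (d : ℕ) (K L : Set (Ed d)) : ℝ :=
  sInf {t : ℝ | 1 ≤ t ∧ ∃ T : Ed d ≃L[ℝ] Ed d, L ⊆ T '' K ∧ T '' K ⊆ t • L}

/-- Action `(Tf)(x) = f(Tx/|Tx|) |Tx|^{-(d+1)}`. -/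
def Tact (d : ℕ) (T : Ed d ≃L[ℝ] Ed d) (f : Ed d → ℝ) (x : Ed d) : ℝ :=
  f ((‖T x‖)⁻¹ • T x) * ‖T x‖ ^ (-((d : ℝ) + 1))

/-- Action `(T̂f)(x) = f(Tx/|Tx|) |Tx|^{-1}`. -/
def hatAct (d : ℕ) (T : Ed d ≃L[ℝ] Ed d) (f : Ed d → ℝ) (x : Ed d) : ℝ :=
  f ((‖T x‖)⁻¹ • T x) * (‖T x‖)⁻¹

/-- `h` is (the restriction to the sphere of) a spherical harmonic of degree `k`:
a harmonic polynomial, homogeneous of degree `k`. -/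
def SphHarm (d k : ℕ) (h : Ed d → ℝ) : Prop :=
  ∃ p : MvPolynomial (Fin d) ℝ, p.IsHomogeneous k ∧
    (∑ i : Fin d, MvPolynomial.pderiv i (MvPolynomial.pderiv i p)) = 0 ∧
    ∀ x ∈ sphereSet d, h x = MvPolynomial.eval (fun i => x i) p

/-- `h` is the degree-`2` spherical harmonic component `H_2^ψ` of `ψ`. -/
def IsDeg2Part (d : ℕ) (ψ h : Ed d → ℝ) : Prop :=
  SphHarm d 2 h ∧ ∀ g : Ed d → ℝ, SphHarm d 2 g →
    ∫ x, (ψ x - h x) * g x ∂ sphereMeasure d = 0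

def unitBall (d : ℕ) : Set (Ed d) := Metric.closedBall 0 1

/-- `W` is the sequence of quermassintegrals of `K`, via the Steiner formula. -/
def IsQuermass (d : ℕ) (K : Set (Ed d)) (W : ℕ → ℝ) : Prop :=
  ∀ t : ℝ, 0 ≤ t → (volume (K + t • unitBall d)).toReal =
    ∑ i ∈ Finset.range (d + 1), (d.choose i : ℝ) * W i * t ^ i

/-- `W` is the sequence of quermassintegrals of `A ⊆ u^⊥` computed within the
`(d-1)`-dimensional space `u^⊥`, via the Steiner formula in `u^⊥`. -/
def IsQuermassHyp (d : ℕ) (u : Ed d) (A : Set (Ed d)) (W : ℕ → ℝ) : Prop :=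
  ∀ t : ℝ, 0 ≤ t →
    (μH[(d : ℝ) - 1] (A + t • (unitBall d ∩ {y | (inner ℝ u y : ℝ) = 0}))).toReal =
      ∑ i ∈ Finset.range d, ((d - 1).choose i : ℝ) * W i * t ^ i

/-- `P` is the `i`-th projection body `Π_i K` of `K`. -/
def IsIthProjBody (d : ℕ) (i : ℕ) (K P : Set (Ed d)) : Prop :=
  IsConvexBody d P ∧ ∀ u : Ed d, ‖u‖ = 1 →
    ∀ W : ℕ → ℝ, IsQuermassHyp d u (projHyp d u '' K) W → suppFn d P u = W i

/-- `ω_n`, the volume of the `n`-dimensional Euclidean unit ball. -/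
def ballVol (n : ℕ) : ℝ := (volume (Metric.closedBall (0 : EuclideanSpace ℝ (Fin n)) 1)).toReal

/-- A set is centrally symmetric if some translate of it equals its reflection in the origin. -/
def IsCentSymm (d : ℕ) (K : Set (Ed d)) : Prop := ∃ v : Ed d, (fun x => x + v) '' K = -K


theorem aux_chart_contDiff (m : ℕ) (i : Fin (m+1)) (s : ℝ) (hs : s ≠ 0) :
    ContDiff ℝ 1 (fun u : Fin m → ℝ =>
      (‖(WithLp.toLp 2 (i.insertNth s u) : EuclideanSpace ℝ (Fin (m+1)))‖⁻¹ : ℝ) •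
        (WithLp.toLp 2 (i.insertNth s u) : EuclideanSpace ℝ (Fin (m+1)))) := by
  have h1 : ContDiff ℝ 1 (fun u : Fin m → ℝ =>
      (WithLp.toLp 2 (i.insertNth s u) : EuclideanSpace ℝ (Fin (m+1)))) := by
    rw [contDiff_euclidean]
    intro j
    refine Fin.succAboveCases i ?_ (fun k => ?_) j
    · simpa using contDiff_const
    · simpa using contDiff_apply ℝ ℝ k
  have h2 : ∀ u : Fin m → ℝ,
      (WithLp.toLp 2 (i.insertNth s u) : EuclideanSpace ℝ (Fin (m+1))) ≠ 0 := by
    intro u h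
    have := congrArg (fun v : EuclideanSpace ℝ (Fin (m+1)) => v i) h
    simp at this
    exact hs this
  refine ContDiff.smul (ContDiff.inv (h1.norm ℝ h2) ?_) h1
  intro u
  exact norm_ne_zero_iff.2 (h2 u)

theorem aux_sphere_lt_top (m : ℕ) :
    μH[(m:ℝ)] (Metric.sphere (0 : EuclideanSpace ℝ (Fin (m+1))) 1) < ⊤ := by
  let φ : Fin (m+1) → ℝ → (Fin m → ℝ) → EuclideanSpace ℝ (Fin (m+1)) := fun i s u =>
      (‖(WithLp.toLp 2 (i.insertNth s u) : EuclideanSpace ℝ (Fin (m+1)))‖⁻¹ : ℝ) •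
        (WithLp.toLp 2 (i.insertNth s u) : EuclideanSpace ℝ (Fin (m+1)))
  let C : Set (Fin m → ℝ) := Set.Icc (-1) 1
  have hvol : μH[(m:ℝ)] C < ⊤ := by
    have := @hausdorffMeasure_pi_real (Fin m) _
    rw [Fintype.card_fin] at this
    rw [this]
    exact isCompact_Icc.measure_lt_top
  have hfin : ∀ i s, s ≠ 0 → μH[(m:ℝ)] (φ i s '' C) < ⊤ := by
    intro i s hs
    obtain ⟨K, hK⟩ := LocallyLipschitzOn.exists_lipschitzOnWith_of_compact
      (isCompact_Icc : IsCompact C)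
      ((aux_chart_contDiff m i s hs).locallyLipschitz.locallyLipschitzOn)
    refine (hK.hausdorffMeasure_image_le (Nat.cast_nonneg m)).trans_lt ?_
    exact ENNReal.mul_lt_top (ENNReal.rpow_lt_top_of_nonneg (Nat.cast_nonneg m) (by simp)) hvol
  have hcov : Metric.sphere (0 : EuclideanSpace ℝ (Fin (m+1))) 1 ⊆
      ⋃ i : Fin (m+1), (φ i 1 '' C ∪ φ i (-1) '' C) := by
    intro x hx
    have hx1 : ‖x‖ = 1 := by simpa using hx
    obtain ⟨i, -, hi⟩ := Finset.exists_max_image Finset.univ (fun j => |x j|) Finset.univ_nonempty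
    have hxi : x i ≠ 0 := by
      intro h0
      have : x = 0 := by
        ext j
        have := hi j (Finset.mem_univ _)
        simpa [h0] using this
      simp [this] at hx1
    have hpos : 0 < |x i| := abs_pos.2 hxi
    have key : ∀ s : ℝ, x i = |x i| * s → x ∈ φ i s '' C := by
      intro s hs
      refine ⟨fun j => |x i|⁻¹ * x (i.succAbove j), ?_, ?_⟩
      · have : ∀ j, |(|x i|⁻¹ * x (i.succAbove j))| ≤ 1 := by
          intro j
          rw [abs_mul, abs_inv, abs_abs, inv_mul_le_iff₀ hpos, mul_one]
          exact hi _ (Finset.mem_univ _)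
        exact ⟨fun j => (abs_le.1 (this j)).1, fun j => (abs_le.1 (this j)).2⟩
      · have hw : (WithLp.toLp 2 (i.insertNth s (fun j => |x i|⁻¹ * x (i.succAbove j))) :
            EuclideanSpace ℝ (Fin (m+1))) = |x i|⁻¹ • x := by
          ext j
          refine Fin.succAboveCases i ?_ (fun k => ?_) j
          · simp only [Fin.insertNth_apply_same, PiLp.smul_apply, smul_eq_mul]
            rw [eq_inv_mul_iff_mul_eq₀ hpos.ne', ← hs]
          · simp
        simp only [φ]
        rw [hw, norm_smul, hx1, smul_smul]
        simp [hpos.ne']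
    refine Set.mem_iUnion.2 ⟨i, ?_⟩
    rcases le_total 0 (x i) with h | h
    · exact Or.inl (key 1 (by rw [abs_of_nonneg h, mul_one]))
    · exact Or.inr (key (-1) (by rw [abs_of_nonpos h]; ring))
  refine (measure_mono hcov).trans_lt ((measure_iUnion_le _).trans_lt ?_)
  rw [tsum_fintype]
  refine ENNReal.sum_lt_top.2 fun i _ => (measure_union_le _ _).trans_lt ?_
  exact ENNReal.add_lt_top.2 ⟨hfin i 1 one_ne_zero, hfin i (-1) (by norm_num)⟩

theorem aux_sphere_pos (m : ℕ) :
    0 < μH[(m:ℝ)] (Metric.sphere (0 : EuclideanSpace ℝ (Fin (m+1))) 1) := by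
  let p : EuclideanSpace ℝ (Fin (m+1)) → (Fin m → ℝ) := fun x j => x j.succ
  have hp : LipschitzWith 1 p := by
    refine LipschitzWith.of_dist_le_mul fun x y => ?_
    rw [NNReal.coe_one, one_mul]
    refine (dist_pi_le_iff dist_nonneg).2 fun j => ?_
    rw [dist_eq_norm, dist_eq_norm]
    exact PiLp.norm_apply_le (x - y) j.succ
  have h1 := hp.hausdorffMeasure_image_le (Nat.cast_nonneg (α := ℝ) m)
    (Metric.sphere (0 : EuclideanSpace ℝ (Fin (m+1))) 1)
  simp only [ENNReal.coe_one, ENNReal.one_rpow, one_mul] at h1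
  refine lt_of_lt_of_le ?_ h1
  have := @hausdorffMeasure_pi_real (Fin m) _
  rw [Fintype.card_fin] at this
  rw [this]
  have hcont : Continuous (fun u : Fin m → ℝ => ∑ j, u j ^ 2) := by fun_prop
  have hopen : IsOpen {u : Fin m → ℝ | ∑ j, u j ^ 2 < 1} := isOpen_lt hcont continuous_const
  refine (hopen.measure_pos volume ⟨0, by simp⟩).trans_le (measure_mono ?_)
  intro u hu
  have hu' : ∑ j, u j ^ 2 < 1 := hu
  refine ⟨WithLp.toLp 2 (Fin.cons (Real.sqrt (1 - ∑ j, u j ^ 2)) u), ?_, ?_⟩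
  · rw [mem_sphere_zero_iff_norm, EuclideanSpace.norm_eq]
    simp only [Fin.sum_univ_succ, Real.norm_eq_abs, sq_abs, Fin.cons_zero, Fin.cons_succ]
    rw [Real.sq_sqrt (by linarith)]
    simp
  · ext j
    simp [p]

theorem aux_sub_image (m : ℕ) (ξ : Ed (m+2)) (hξ : ‖ξ‖ = 1) :
    subSphere (m+2) ξ Set.univ =
      μH[(m:ℝ)] (Metric.sphere (0 : EuclideanSpace ℝ (Fin (m+1))) 1) := by
  have h0 : ξ ≠ 0 := by
    intro h
    simp [h] at hξ
  haveI : Fact (Module.finrank ℝ (Ed (m+2)) = (m+1) + 1) := ⟨by simp⟩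
  let b := (stdOrthonormalBasis ℝ (ℝ ∙ ξ)ᗮ).reindex
    (finCongr (Submodule.finrank_orthogonal_span_singleton (n := m+1) (𝕜 := ℝ) h0))
  let L : EuclideanSpace ℝ (Fin (m+1)) → Ed (m+2) := fun y => ((b.repr.symm y : (ℝ ∙ ξ)ᗮ) : Ed (m+2))
  have hL : Isometry L := isometry_subtype_coe.comp b.repr.symm.isometry
  have him : L '' (Metric.sphere (0 : EuclideanSpace ℝ (Fin (m+1))) 1) =
      sphereSet (m+2) ∩ {y | (inner ℝ ξ y : ℝ) = 0} := by
    ext y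
    constructor
    · rintro ⟨z, hz, rfl⟩
      refine ⟨?_, ?_⟩
      · have hz' : ‖z‖ = 1 := by simpa using hz
        simp only [sphereSet, mem_sphere_zero_iff_norm, L]
        rw [← hz']
        exact b.repr.symm.norm_map z
      · exact Submodule.mem_orthogonal_singleton_iff_inner_right.1 (b.repr.symm z).2
    · rintro ⟨hy1, hy2⟩
      have hy : y ∈ (ℝ ∙ ξ)ᗮ := Submodule.mem_orthogonal_singleton_iff_inner_right.2 hy2
      refine ⟨b.repr ⟨y, hy⟩, ?_, ?_⟩
      · simp only [mem_sphere_zero_iff_norm, LinearIsometryEquiv.norm_map]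
        simpa [sphereSet] using hy1
      · simp [L]
  rw [subSphere, Measure.restrict_apply_univ, ← him]
  have : ((m + 2 : ℕ) : ℝ) - 2 = m := by push_cast; ring
  rw [this]
  exact hL.hausdorffMeasure_image (Or.inl (Nat.cast_nonneg m)) _

theorem aux_sphVol_pos (m : ℕ) : 0 < sphVol (m+1) := by
  have : ((m + 1 : ℕ) : ℝ) - 1 = m := by push_cast; ring
  rw [sphVol, this]
  exact ENNReal.toReal_pos (aux_sphere_pos m).ne' (aux_sphere_lt_top m).ne

theorem aux_finite (m : ℕ) (ξ : Ed (m+2)) (hξ : ‖ξ‖ = 1) : IsFiniteMeasure (subSphere (m+2) ξ) :=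
  ⟨by rw [aux_sub_image m ξ hξ]; exact aux_sphere_lt_top m⟩

theorem aux_meas (d : ℕ) (ξ : Ed d) :
    MeasurableSet (sphereSet d ∩ {y | (inner ℝ ξ y : ℝ) = 0}) := by
  refine (isClosed_sphere.inter ?_).measurableSet
  exact isClosed_eq (by fun_prop) continuous_const

theorem aux_ae (d : ℕ) (ξ : Ed d) :
    ∀ᵐ y ∂(subSphere d ξ), ‖y‖ = 1 ∧ (inner ℝ ξ y : ℝ) = 0 := by
  filter_upwards [ae_restrict_mem (aux_meas d ξ)] with y hy
  exact ⟨by simpa [sphereSet] using hy.1, hy.2⟩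

theorem aux_integrable (m : ℕ) (ξ : Ed (m+2)) (hξ : ‖ξ‖ = 1) (f : Ed (m+2) → ℝ)
    (hf : Continuous f) : Integrable f (subSphere (m+2) ξ) := by
  haveI := aux_finite m ξ hξ
  obtain ⟨C, hC⟩ := (isCompact_sphere (0 : Ed (m+2)) 1).exists_bound_of_continuousOn
    hf.continuousOn
  refine Integrable.of_bound hf.aestronglyMeasurable C ?_
  filter_upwards [aux_ae (m+2) ξ] with y hy
  exact hC y (by simpa using hy.1)

theorem aux_iter {α S : Type*} [MeasurableSpace α] [Fintype S] (μ : Measure α) (n : ℕ) :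
    ∀ (c : S → ℝ) (f : S → Fin n → α → ℝ), (∀ s k, Integrable (f s k) μ) →
      iterInt n μ (fun v => ∑ s, c s * ∏ k, f s k (v k)) = ∑ s, c s * ∏ k, ∫ x, f s k x ∂μ := by
  induction n with
  | zero => intro c f hf; simp [iterInt]
  | succ n ih =>
    intro c f hf
    have h1 : ∀ t, iterInt n μ (fun v => ∑ s, c s * ∏ k, f s k ((Fin.cons t v : Fin (n+1) → α) k))
        = ∑ s, (c s * f s 0 t) * ∏ k : Fin n, ∫ x, f s k.succ x ∂μ := by
      intro t
      rw [← ih (fun s => c s * f s 0 t) (fun s k => f s k.succ) (fun s k => hf s _)]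
      congr 1
      ext v
      simp [Fin.prod_univ_succ, mul_assoc]
    simp only [iterInt]
    simp_rw [h1]
    rw [integral_finsetSum]
    · refine Finset.sum_congr rfl fun s _ => ?_
      rw [integral_mul_const, integral_const_mul, Fin.prod_univ_succ, mul_assoc]
    · intro s _
      exact ((hf s 0).const_mul _).mul_const _

theorem aux_QInt (m : ℕ) (g : Fin (m+1) → Ed (m+2) → ℝ) (hg : ∀ k, Continuous (g k))
    (ξ : Ed (m+2)) (hξ : ‖ξ‖ = 1) :
    QInt (m+2) g ξ = ∑ σ₁ : Equiv.Perm (Fin (m+2)), ∑ σ₂ : Equiv.Perm (Fin (m+2)),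
      ((Equiv.Perm.sign σ₁ : ℤ) : ℝ) * ((Equiv.Perm.sign σ₂ : ℤ) : ℝ) *
      ξ (σ₁ (Fin.last _)) * ξ (σ₂ (Fin.last _)) *
      ∏ k : Fin (m+1), ∫ x, x (σ₁ k.castSucc) * x (σ₂ k.castSucc) * g k x ∂subSphere (m+2) ξ := by
  rw [← Fintype.sum_prod_type']
  have := aux_iter (subSphere (m+2) ξ) (m+1)
    (fun s : Equiv.Perm (Fin (m+2)) × Equiv.Perm (Fin (m+2)) =>
      ((Equiv.Perm.sign s.1 : ℤ) : ℝ) * ((Equiv.Perm.sign s.2 : ℤ) : ℝ) *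
      ξ (s.1 (Fin.last _)) * ξ (s.2 (Fin.last _)))
    (fun s k x => x (s.1 k.castSucc) * x (s.2 k.castSucc) * g k x)
    (fun s k => aux_integrable m ξ hξ _ (by have := hg k; fun_prop))
  rw [← this]
  unfold QInt
  show iterInt (m+1) _ _ = _
  congr 1
  ext v
  have hdet : detCols (m+2) v ξ = ∑ σ : Equiv.Perm (Fin (m+2)),
      ((Equiv.Perm.sign σ : ℤ) : ℝ) * ξ (σ (Fin.last _)) *
        ∏ k : Fin (m+1), v k (σ k.castSucc) := by
    unfold detCols
    rw [Matrix.det_apply']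
    refine Finset.sum_congr rfl fun σ _ => ?_
    rw [Fin.prod_univ_castSucc, mul_assoc]
    congr 1
    rw [mul_comm]
    congr 1
    · simp
    · refine Finset.prod_congr rfl fun k _ => ?_
      have : (k : ℕ) < m + 1 := k.2
      simp
      intro hlt
      omega
  rw [hdet, sq, Finset.sum_mul_sum, Fintype.sum_prod_type, Finset.sum_mul]
  refine Finset.sum_congr rfl fun σ₁ _ => ?_
  rw [Finset.sum_mul]
  refine Finset.sum_congr rfl fun σ₂ _ => ?_
  simp only [Finset.prod_mul_distrib]
  generalize hG : (∏ k : Fin (m+1), g k (v k)) = G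
  have hG' : (∏ k : Fin (m+2-1), g k (v k)) = G := hG
  rw [hG']
  ring

theorem aux_mp (d : ℕ) (ξ : Ed d) (e : Ed d ≃ₗᵢ[ℝ] Ed d) (he : e ξ = ξ) (f : Ed d → ℝ) :
    ∫ x, f (e x) ∂subSphere d ξ = ∫ x, f x ∂subSphere d ξ := by
  have h := (e.toIsometryEquiv.measurePreserving_hausdorffMeasure ((d:ℝ) - 2)).restrict_preimage
    (aux_meas d ξ)
  have hpre : e.toIsometryEquiv ⁻¹' (sphereSet d ∩ {y | (inner ℝ ξ y : ℝ) = 0}) =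
      sphereSet d ∩ {y | (inner ℝ ξ y : ℝ) = 0} := by
    ext y
    have : (inner ℝ ξ (e y) : ℝ) = inner ℝ ξ y := by
      conv_lhs => rw [← he]
      exact e.inner_map_map ξ y
    simp [sphereSet, this]
  rw [hpre] at h
  exact h.integral_comp e.toHomeomorph.measurableEmbedding f

theorem aux_diag (m : ℕ) (a b : Fin (m+2)) (hab : a ≠ b) :
    ∫ x, x a * x b ∂subSphere (m+2) (EuclideanSpace.single (0 : Fin (m+2)) (1:ℝ)) = 0 := by
  set ξ : Ed (m+2) := EuclideanSpace.single (0 : Fin (m+2)) (1:ℝ)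
  wlog hb : b ≠ 0 generalizing a b
  · have ha : a ≠ 0 := by
      intro h
      exact hab (by rw [h]; push Not at hb; exact hb.symm)
    have := this b a hab.symm ha
    simpa [mul_comm] using this
  let e : Ed (m+2) ≃ₗᵢ[ℝ] Ed (m+2) := LinearIsometryEquiv.piLpCongrRight 2
    (fun i => if i = b then LinearIsometryEquiv.neg ℝ else LinearIsometryEquiv.refl ℝ ℝ)
  have hea : ∀ x : Ed (m+2), ∀ i, i ≠ b → e x i = x i := by
    intro x i hi
    simp [e, hi]
  have heb : ∀ x : Ed (m+2), e x b = - x b := by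
    intro x
    simp [e]
  have he : e ξ = ξ := by
    ext i
    by_cases hi : i = b
    · subst hi
      rw [heb]
      simp [ξ, hb]
    · exact hea _ _ hi
  have := aux_mp (m+2) ξ e he (fun x => x a * x b)
  simp only [hea _ _ hab, heb, mul_neg, integral_neg] at this
  linarith

theorem aux_sq_pos (m : ℕ) (a : Fin (m+2)) (ha : a ≠ 0) :
    0 < ∫ x, x a * x a ∂subSphere (m+2) (EuclideanSpace.single (0 : Fin (m+2)) (1:ℝ)) := by
  set ξ : Ed (m+2) := EuclideanSpace.single (0 : Fin (m+2)) (1:ℝ) with hξdef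
  have hξ : ‖ξ‖ = 1 := by simp [ξ]
  have h0 : ∫ x, x 0 * x 0 ∂subSphere (m+2) ξ = 0 := by
    rw [← integral_zero (Ed (m+2)) ℝ (μ := subSphere (m+2) ξ)]
    refine integral_congr_ae ?_
    filter_upwards [aux_ae (m+2) ξ] with y hy
    have : y 0 = 0 := by simpa [ξ, EuclideanSpace.inner_single_left] using hy.2
    simp [this]
  have hswap : ∀ b : Fin (m+2), b ≠ 0 →
      ∫ x, x b * x b ∂subSphere (m+2) ξ = ∫ x, x a * x a ∂subSphere (m+2) ξ := by
    intro b hb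
    let e : Ed (m+2) ≃ₗᵢ[ℝ] Ed (m+2) :=
      LinearIsometryEquiv.piLpCongrLeft 2 ℝ ℝ (Equiv.swap a b)
    have hev : ∀ x : Ed (m+2), ∀ i, e x i = x (Equiv.swap a b i) := by
      intro x i
      simp [e, LinearIsometryEquiv.piLpCongrLeft_apply]
    have he : e ξ = ξ := by
      ext i
      rw [hev]
      simp only [ξ, EuclideanSpace.single_apply]
      have : Equiv.swap a b i = 0 ↔ i = 0 := by
        rw [← Equiv.swap_apply_of_ne_of_ne ha.symm hb.symm, Equiv.apply_eq_iff_eq]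
        rw [Equiv.swap_apply_of_ne_of_ne ha.symm hb.symm]
      simp [this]
    have := aux_mp (m+2) ξ e he (fun x => x a * x a)
    simpa [hev] using this
  have hsum : ∑ b, ∫ x, x b * x b ∂subSphere (m+2) ξ = (subSphere (m+2) ξ).real Set.univ := by
    rw [← integral_finsetSum]
    · have : (subSphere (m+2) ξ).real Set.univ = ∫ x, (1:ℝ) ∂subSphere (m+2) ξ := by simp
      rw [this]
      refine integral_congr_ae ?_
      filter_upwards [aux_ae (m+2) ξ] with y hy
      have := EuclideanSpace.real_norm_sq_eq y
      rw [hy.1] at this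
      simp only [← sq]
      linarith
    · intro i _
      exact aux_integrable m ξ hξ _ (by fun_prop)
  have hpos : 0 < (subSphere (m+2) ξ).real Set.univ := by
    rw [Measure.real, aux_sub_image m ξ hξ]
    exact ENNReal.toReal_pos (aux_sphere_pos m).ne' (aux_sphere_lt_top m).ne
  have hnn : 0 ≤ ∫ x, x a * x a ∂subSphere (m+2) ξ := integral_nonneg fun x => mul_self_nonneg _
  refine lt_of_le_of_ne hnn fun hz => ?_
  rw [← hsum, Finset.sum_eq_zero] at hpos
  · exact lt_irrefl _ hpos
  · intro b _
    by_cases hb : b = 0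
    · rw [hb, h0]
    · rw [hswap b hb, ← hz]

theorem aux_cQ_pos (m : ℕ) : 0 < cQ (m+2) := by
  have hpos : 0 < m + 2 := by omega
  rw [cQ, dif_pos hpos]
  refine inv_pos.2 ?_
  have hz : (⟨0, hpos⟩ : Fin (m+2)) = 0 := rfl
  rw [hz]
  have hξ : ‖(EuclideanSpace.single (0 : Fin (m+2)) (1:ℝ) : Ed (m+2))‖ = 1 := by simp
  have hq := aux_QInt m (fun _ _ => 1) (fun _ => continuous_const)
    (EuclideanSpace.single (0 : Fin (m+2)) (1:ℝ)) hξ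
  have hdiag : ∀ σ₁ : Equiv.Perm (Fin (m+2)), ∀ σ₂, σ₂ ≠ σ₁ → ∏ k : Fin (m+1),
      ∫ x, x (σ₁ k.castSucc) * x (σ₂ k.castSucc) * 1
        ∂subSphere (m+2) (EuclideanSpace.single (0 : Fin (m+2)) (1:ℝ)) = 0 := by
    intro σ₁ σ₂ hne
    by_contra hprod
    rw [← ne_eq, Finset.prod_ne_zero_iff] at hprod
    have hk : ∀ k : Fin (m+1), σ₁ k.castSucc = σ₂ k.castSucc := by
      intro k
      by_contra hk
      refine hprod k (Finset.mem_univ _) ?_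
      simp only [mul_one]
      exact aux_diag m _ _ hk
    apply hne
    have hmul : ∀ k : Fin (m+1), (σ₁⁻¹ * σ₂) k.castSucc = k.castSucc := by
      intro k
      simp [← hk k]
    have hlast : (σ₁⁻¹ * σ₂) (Fin.last _) = Fin.last _ := by
      refine Fin.lastCases (motive := fun j => (σ₁⁻¹ * σ₂) (Fin.last _) = j → j = Fin.last _)
        (fun _ => rfl) (fun k hk => ?_) ((σ₁⁻¹ * σ₂) (Fin.last (m+1))) rfl
      rw [← hmul k] at hk
      have := (σ₁⁻¹ * σ₂).injective hk
      exact absurd this (Fin.castSucc_lt_last k).ne'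
    have h1 : σ₁⁻¹ * σ₂ = 1 := by
      ext j
      refine Fin.lastCases ?_ (fun k => ?_) j
      · rw [hlast]; rfl
      · rw [hmul k]; rfl
    exact (inv_mul_eq_one.1 h1).symm
  rw [show QInt (m+2) (fun _ _ => 1) _ = _ from hq]
  have hterm : ∀ σ₁ : Equiv.Perm (Fin (m+2)), (∑ σ₂ : Equiv.Perm (Fin (m+2)),
      ((Equiv.Perm.sign σ₁ : ℤ) : ℝ) * ((Equiv.Perm.sign σ₂ : ℤ) : ℝ) *
      (EuclideanSpace.single (0 : Fin (m+2)) (1:ℝ) : Ed (m+2)) (σ₁ (Fin.last _)) *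
      (EuclideanSpace.single (0 : Fin (m+2)) (1:ℝ) : Ed (m+2)) (σ₂ (Fin.last _)) *
      ∏ k : Fin (m+1), ∫ x, x (σ₁ k.castSucc) * x (σ₂ k.castSucc) * 1
        ∂subSphere (m+2) (EuclideanSpace.single (0 : Fin (m+2)) (1:ℝ))) =
      ((EuclideanSpace.single (0 : Fin (m+2)) (1:ℝ) : Ed (m+2)) (σ₁ (Fin.last _))) ^ 2 *
      ∏ k : Fin (m+1), ∫ x, x (σ₁ k.castSucc) * x (σ₁ k.castSucc)
        ∂subSphere (m+2) (EuclideanSpace.single (0 : Fin (m+2)) (1:ℝ)) := by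
    intro σ₁
    rw [Finset.sum_eq_single σ₁]
    · have : ((Equiv.Perm.sign σ₁ : ℤ) : ℝ) * ((Equiv.Perm.sign σ₁ : ℤ) : ℝ) = 1 := by
        rw [← Int.cast_mul, ← Units.val_mul, Int.units_mul_self]; simp
      rw [this]
      simp only [mul_one]
      ring
    · intro σ₂ _ hne
      rw [hdiag σ₁ σ₂ hne, mul_zero]
    · intro h
      exact absurd (Finset.mem_univ _) h
  simp_rw [hterm]
  refine Finset.sum_pos' (fun σ _ => ?_) ⟨Equiv.swap 0 (Fin.last _), Finset.mem_univ _, ?_⟩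
  · exact mul_nonneg (sq_nonneg _)
      (Finset.prod_nonneg fun k _ => integral_nonneg fun x => mul_self_nonneg _)
  · refine mul_pos (by simp) (Finset.prod_pos fun k _ => aux_sq_pos m _ ?_)
    intro h
    have h2 : Equiv.swap (0 : Fin (m+2)) (Fin.last _) k.castSucc =
      Equiv.swap (0 : Fin (m+2)) (Fin.last _) (Fin.last _) := by rw [h]; simp
    exact (Fin.castSucc_lt_last k).ne ((Equiv.swap _ _).injective h2)

/-- The expansion of the `Q`-transform as a double sum over permutations of products of Radon
transforms. -/
theorem Q_eq_perm_sum (d : ℕ) (hd : 3 ≤ d) :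
    ∃ c : ℝ, 0 < c ∧ ∀ g : Fin (d - 1) → Ed d → ℝ, (∀ k, Continuous (g k)) →
      ∀ ξ : Ed d, ‖ξ‖ = 1 →
        Qfun d g ξ =
          c * ∑ σ₁ : Equiv.Perm (Fin d), ∑ σ₂ : Equiv.Perm (Fin d),
            ((Equiv.Perm.sign σ₁ : ℤ) : ℝ) * ((Equiv.Perm.sign σ₂ : ℤ) : ℝ) *
            ξ (σ₁ ⟨d - 1, by omega⟩) * ξ (σ₂ ⟨d - 1, by omega⟩) *
            ∏ k : Fin (d - 1),
              Radon d (fun x =>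
                x (σ₁ (Fin.castLE (by omega) k)) * x (σ₂ (Fin.castLE (by omega) k)) * g k x)
                ξ := by
  obtain ⟨m, rfl⟩ : ∃ m, d = m + 2 := ⟨d - 2, by omega⟩
  have hV : 0 < sphVol (m+1) := aux_sphVol_pos m
  refine ⟨cQ (m+2) * sphVol (m+1) ^ (m+1), mul_pos (aux_cQ_pos m) (pow_pos hV _), ?_⟩
  intro g hg ξ hξ
  rw [Qfun, show QInt (m+2) g ξ = _ from aux_QInt m g hg ξ hξ, mul_assoc]
  congr 1
  rw [Finset.mul_sum]
  refine Finset.sum_congr rfl fun σ₁ _ => ?_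
  rw [Finset.mul_sum]
  refine Finset.sum_congr rfl fun σ₂ _ => ?_
  have hR : ∏ k : Fin (m+1), ∫ x, x (σ₁ k.castSucc) * x (σ₂ k.castSucc) * g k x
        ∂subSphere (m+2) ξ = sphVol (m+1) ^ (m+1) * ∏ k : Fin (m+1), Radon (m+2) (fun x =>
          x (σ₁ k.castSucc) * x (σ₂ k.castSucc) * g k x) ξ := by
    have : ∀ k : Fin (m+1), ∫ x, x (σ₁ k.castSucc) * x (σ₂ k.castSucc) * g k x
        ∂subSphere (m+2) ξ = sphVol (m+1) * Radon (m+2) (fun x =>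
          x (σ₁ k.castSucc) * x (σ₂ k.castSucc) * g k x) ξ := by
      intro k
      show _ = sphVol (m+1) * ((sphVol (m+1))⁻¹ * _)
      rw [mul_inv_cancel_left₀ hV.ne']
    simp_rw [this]
    rw [Finset.prod_mul_distrib]
    simp
  rw [hR, mul_left_comm]
  rfl

end
end

section
/- Let d ≥ 3, let ψ : S^{d-1} → ℝ be continuous and bounded, and let 2 ≤ k ≤ d−1. Then ‖Q(|ψ|[k], 1[d-1-k])‖_2 ≤ ‖ψ‖_∞^{k-1} ‖ψ‖_2, where the L² and L^∞ norms are taken on S^{d-1}. -/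
open MeasureTheory Metric Filter Topology
open scoped Pointwise ENNReal

noncomputable section

/-! ### Finiteness of the Hausdorff measure of spheres -/

lemma hausdorff_image_closedBall_lt_top {E : Type*} [NormedAddCommGroup E] [NormedSpace ℝ E]
    [MeasurableSpace E] [BorelSpace E] {m : ℕ} {f : (Fin m → ℝ) → E} (hf : ContDiff ℝ 1 f)
    (r : ℝ) : μH[(m : ℝ)] (f '' Metric.closedBall 0 r) < ∞ := by
  obtain ⟨K, hK⟩ := (hf.locallyLipschitz.locallyLipschitzOn
    (s := Metric.closedBall 0 r)).exists_lipschitzOnWith_of_compact (isCompact_closedBall 0 r)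
  refine (hK.hausdorffMeasure_image_le (Nat.cast_nonneg m)).trans_lt ?_
  have h1 : (μH[(m : ℝ)] : Measure (Fin m → ℝ)) = volume := by
    have := hausdorffMeasure_pi_real (ι := Fin m)
    simpa using this
  rw [h1]
  exact ENNReal.mul_lt_top (by simp) (isCompact_closedBall 0 r).measure_lt_top

lemma hausdorff_sphere_lt_top {E : Type*} [NormedAddCommGroup E] [InnerProductSpace ℝ E]
    [FiniteDimensional ℝ E] [MeasurableSpace E] [BorelSpace E] {m : ℕ}
    (hE : Module.finrank ℝ E = m + 1) :
    μH[(m : ℝ)] (Metric.sphere (0 : E) 1) < ∞ := by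
  have hc : IsCompact (Metric.sphere (0 : E) 1) := isCompact_sphere 0 1
  refine hc.induction_on (p := fun s => μH[(m : ℝ)] s < ∞) (by simp)
    (fun s t hst ht => (measure_mono hst).trans_lt ht)
    (fun s t hs ht => (measure_union_le s t).trans_lt (ENNReal.add_lt_top.2 ⟨hs, ht⟩)) ?_
  intro p hp
  have hp1 : ‖p‖ = 1 := by simpa using hp
  have hp0 : p ≠ 0 := by
    intro h; simp [h] at hp1
  have hfr : Module.finrank ℝ (Fin m → ℝ) = Module.finrank ℝ (ℝ ∙ p)ᗮ := by
    have : Fact (Module.finrank ℝ E = m + 1) := ⟨hE⟩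
    rw [Submodule.finrank_orthogonal_span_singleton (n := m) hp0]
    simp
  let L : (Fin m → ℝ) ≃L[ℝ] (ℝ ∙ p)ᗮ := ContinuousLinearEquiv.ofFinrankEq hfr
  have hort : ∀ y : Fin m → ℝ, inner ℝ p ((L y : (ℝ ∙ p)ᗮ) : E) = 0 := fun y =>
    Submodule.mem_orthogonal_singleton_iff_inner_right.1 (L y).2
  have hne : ∀ y : Fin m → ℝ, p + ((L y : (ℝ ∙ p)ᗮ) : E) ≠ 0 := by
    intro y h
    have := congrArg (fun z => inner ℝ p z) h
    simp only [inner_add_right, hort, inner_zero_right, real_inner_self_eq_norm_sq, hp1] at this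
    norm_num at this
  let f : (Fin m → ℝ) → E := fun y =>
    (‖p + ((L y : (ℝ ∙ p)ᗮ) : E)‖)⁻¹ • (p + ((L y : (ℝ ∙ p)ᗮ) : E))
  have hlin : ContDiff ℝ 1 (fun y : Fin m → ℝ => p + ((L y : (ℝ ∙ p)ᗮ) : E)) :=
    contDiff_const.add (((ℝ ∙ p)ᗮ.subtypeL.comp (L : (Fin m → ℝ) →L[ℝ] (ℝ ∙ p)ᗮ)).contDiff)
  have hf : ContDiff ℝ 1 f := by
    refine ContDiff.smul (ContDiff.inv (hlin.norm ℝ hne) ?_) hlin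
    intro y; exact norm_ne_zero_iff.2 (hne y)
  obtain ⟨R, hR⟩ := (LinearMap.continuous_of_finiteDimensional
    (L.symm.toLinearEquiv : (ℝ ∙ p)ᗮ →ₗ[ℝ] (Fin m → ℝ))) |>.continuousOn (s := Metric.closedBall 0 2)
      |> (isCompact_closedBall (0 : (ℝ ∙ p)ᗮ) 2).exists_bound_of_continuousOn
  refine ⟨{x | (1:ℝ)/2 < inner ℝ p x} ∩ Metric.sphere 0 1, ?_, ?_⟩
  · refine inter_mem (mem_nhdsWithin_of_mem_nhds ?_) self_mem_nhdsWithin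
    refine IsOpen.mem_nhds (isOpen_lt continuous_const (by fun_prop)) ?_
    simp only [Set.mem_ofPred_eq, real_inner_self_eq_norm_sq, hp1]; norm_num
  · refine (measure_mono ?_).trans_lt (hausdorff_image_closedBall_lt_top hf R)
    rintro x ⟨hx, hxs⟩
    have hx1 : ‖x‖ = 1 := by simpa using hxs
    simp only [Set.mem_ofPred_eq] at hx
    set c := inner ℝ p x with hc
    have hc0 : 0 < c := by linarith
    have hmem : c⁻¹ • x - p ∈ (ℝ ∙ p)ᗮ := by
      rw [Submodule.mem_orthogonal_singleton_iff_inner_right, inner_sub_right, inner_smul_right,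
        ← hc, real_inner_self_eq_norm_sq, hp1]
      field_simp; simp
    have hnorm : ‖(⟨c⁻¹ • x - p, hmem⟩ : (ℝ ∙ p)ᗮ)‖ ≤ 2 := by
      have h1 : ‖c⁻¹ • x - p‖ ^ 2 = c⁻¹ ^ 2 - 1 := by
        rw [norm_sub_sq_real, norm_smul, hx1, hp1, inner_smul_left, real_inner_comm, ← hc]
        simp [abs_of_pos hc0]; field_simp; ring
      have h2 : c⁻¹ ≤ 2 := by
        rw [inv_le_comm₀ hc0 (by norm_num)]; linarith
      have h3 : 0 < c⁻¹ := inv_pos.2 hc0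
      change ‖c⁻¹ • x - p‖ ≤ 2
      nlinarith [norm_nonneg (c⁻¹ • x - p)]
    refine ⟨L.symm ⟨c⁻¹ • x - p, hmem⟩, ?_, ?_⟩
    · have := hR ⟨c⁻¹ • x - p, hmem⟩ (by simpa using hnorm)
      simpa using this
    · simp only [f, ContinuousLinearEquiv.apply_symm_apply, add_sub_cancel, norm_smul, hx1, smul_smul]
      simp [abs_of_pos hc0, hc0.ne']

/-! ### Invariance of the measures -/

lemma isCompact_sphereSet (d : ℕ) : IsCompact (sphereSet d) := isCompact_sphere 0 1

lemma measurableSet_sphereSet (d : ℕ) : MeasurableSet (sphereSet d) :=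
  (isCompact_sphereSet d).isClosed.measurableSet

lemma mem_sphereSet {d : ℕ} {x : Ed d} : x ∈ sphereSet d ↔ ‖x‖ = 1 := by
  simp [sphereSet]

lemma isClosed_sub (d : ℕ) (x : Ed d) :
    IsClosed (sphereSet d ∩ {y | (inner ℝ x y : ℝ) = 0}) :=
  (isCompact_sphereSet d).isClosed.inter (isClosed_eq (by fun_prop) continuous_const)

lemma isCompact_sub (d : ℕ) (x : Ed d) :
    IsCompact (sphereSet d ∩ {y | (inner ℝ x y : ℝ) = 0}) :=
  (isCompact_sphereSet d).inter_right (isClosed_eq (by fun_prop) continuous_const)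

lemma sphereMeasure_finite (d : ℕ) (hd : 3 ≤ d) : IsFiniteMeasure (sphereMeasure d) := by
  obtain ⟨n, rfl⟩ : ∃ n, d = n + 1 := ⟨d - 1, by omega⟩
  refine ⟨?_⟩
  rw [sphereMeasure, Measure.restrict_apply_univ]
  have := hausdorff_sphere_lt_top (E := Ed (n + 1)) (m := n) (by simp)
  have h2 : (((n + 1 : ℕ) : ℝ) - 1) = n := by push_cast; ring
  rw [h2]; exact this

lemma subSphere_finite (d : ℕ) (hd : 3 ≤ d) (x : Ed d) (hx : x ∈ sphereSet d) :
    IsFiniteMeasure (subSphere d x) := by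
  obtain ⟨n, rfl⟩ : ∃ n, d = n + 2 := ⟨d - 2, by omega⟩
  refine ⟨?_⟩
  have hx1 := mem_sphereSet.1 hx
  have hx0 : x ≠ 0 := by
    intro h; simp [h] at hx1
  have : Fact (Module.finrank ℝ (Ed (n + 2)) = n + 1 + 1) := ⟨by simp⟩
  rw [subSphere, Measure.restrict_apply_univ]
  have h1 := hausdorff_sphere_lt_top (E := (ℝ ∙ x)ᗮ) (m := n)
    (Submodule.finrank_orthogonal_span_singleton (n := n + 1) hx0)
  have h2 : (((n + 2 : ℕ) : ℝ) - 2) = n := by push_cast; ring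
  rw [h2]
  rw [← (ℝ ∙ x)ᗮ.subtypeₗᵢ.isometry.hausdorffMeasure_image (Or.inl (Nat.cast_nonneg n))] at h1
  refine (measure_mono ?_).trans_lt h1
  rintro y ⟨hy, hy'⟩
  refine ⟨⟨y, Submodule.mem_orthogonal_singleton_iff_inner_right.2 hy'⟩, ?_, rfl⟩
  simpa using mem_sphereSet.1 hy

lemma map_sphereMeasure {d : ℕ} (g : Ed d ≃ₗᵢ[ℝ] Ed d) :
    (sphereMeasure d).map g = sphereMeasure d := by
  have hpre : g ⁻¹' (sphereSet d) = sphereSet d := by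
    ext y; simp [mem_sphereSet]
  have h := Measure.restrict_map (μ := (μH[(d : ℝ) - 1] : Measure (Ed d))) (f := g)
    g.continuous.measurable (measurableSet_sphereSet d)
  rw [hpre] at h
  rw [sphereMeasure, ← h]
  congr 1
  exact g.toIsometryEquiv.map_hausdorffMeasure _

lemma map_subSphere {d : ℕ} (g : Ed d ≃ₗᵢ[ℝ] Ed d) (x : Ed d) :
    (subSphere d x).map g = subSphere d (g x) := by
  have hpre : g ⁻¹' (sphereSet d ∩ {y | (inner ℝ (g x) y : ℝ) = 0}) =
      sphereSet d ∩ {y | (inner ℝ x y : ℝ) = 0} := by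
    ext y; simp [mem_sphereSet]
  have h := Measure.restrict_map (μ := (μH[(d : ℝ) - 2] : Measure (Ed d))) (f := g)
    g.continuous.measurable (isClosed_sub d (g x)).measurableSet
  rw [hpre] at h
  rw [subSphere, ← h, subSphere]
  congr 1
  exact g.toIsometryEquiv.map_hausdorffMeasure _

lemma subSphere_neg {d : ℕ} (x : Ed d) : subSphere d (-x) = subSphere d x := by
  simp [subSphere]

/-- The reflection exchanging `x` and `-y`. -/
def reflS (d : ℕ) (x y : Ed d) : Ed d ≃ₗᵢ[ℝ] Ed d := (ℝ ∙ (y + x))ᗮ.reflection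

lemma refl_apply_self {d : ℕ} {x e : Ed d} (hx : x ∈ sphereSet d) (he : e ∈ sphereSet d) :
    reflS d x e e = -x := by
  have := Submodule.reflection_sub (v := e) (w := -x)
    (by rw [norm_neg, mem_sphereSet.1 hx, mem_sphereSet.1 he])
  rw [sub_neg_eq_add] at this
  exact this

lemma map_refl_subSphere {d : ℕ} {x e : Ed d} (hx : x ∈ sphereSet d) (he : e ∈ sphereSet d) :
    (subSphere d e).map (reflS d x e) = subSphere d x := by
  rw [map_subSphere, refl_apply_self hx he, subSphere_neg]

lemma refl_formula {d : ℕ} (x e y : Ed d) : reflS d x e y =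
    y - (2 * (inner ℝ (e + x) y / ‖e + x‖ ^ 2)) • (e + x) := by
  rw [reflS, Submodule.reflection_orthogonal_apply, Submodule.reflection_singleton_apply]
  simp only [RCLike.ofReal_real_eq_id, id_eq, mul_smul, neg_sub]
  simp [two_smul]

lemma measurable_refl {d : ℕ} (e : Ed d) :
    Measurable (fun p : Ed d × Ed d => reflS d p.1 e p.2) := by
  simp only [refl_formula]
  fun_prop

lemma exists_isometry {d : ℕ} {x y : Ed d} (hx : x ∈ sphereSet d) (hy : y ∈ sphereSet d) :
    ∃ g : Ed d ≃ₗᵢ[ℝ] Ed d, g x = y := by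
  refine ⟨(ℝ ∙ (x - y))ᗮ.reflection, Submodule.reflection_sub ?_⟩
  rw [mem_sphereSet.1 hx, mem_sphereSet.1 hy]

/-! ### Uniqueness of invariant measures (Christensen) -/

lemma exists_kernel {X : Type*} [MetricSpace X] [MeasurableSpace X] [BorelSpace X]
    [SecondCountableTopology X] (ε : ℝ) :
    ∃ K : X → X → ℝ≥0∞, Measurable (fun p : X × X => K p.1 p.2) ∧
      (∀ (μ : Measure X) (y : X), ∫⁻ x, K x y ∂μ = μ (ball y ε)) ∧
      (∀ (μ : Measure X) (x : X), ∫⁻ y, K x y ∂μ = μ (ball x ε)) ∧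
      (∀ x y, ¬ dist x y < ε → K x y = 0) := by
  have hD : MeasurableSet {p : X × X | dist p.1 p.2 < ε} :=
    (isOpen_lt (by fun_prop) continuous_const).measurableSet
  refine ⟨fun x y => (ball y ε).indicator 1 x, ?_, ?_, ?_, ?_⟩
  · exact (measurable_one.indicator hD :
      Measurable (({p : X × X | dist p.1 p.2 < ε}).indicator (1 : X × X → ℝ≥0∞)))
  · intro μ y
    exact lintegral_indicator_one measurableSet_ball
  · intro μ x
    rw [← lintegral_indicator_one measurableSet_ball]
    refine lintegral_congr fun y => ?_
    change (ball y ε).indicator 1 x = (ball x ε).indicator 1 y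
    by_cases h : dist x y < ε
    · rw [Set.indicator_of_mem (show x ∈ ball y ε from h),
        Set.indicator_of_mem (show y ∈ ball x ε from mem_ball_comm.1 h)]
      rfl
    · rw [Set.indicator_of_notMem (show x ∉ ball y ε from h),
        Set.indicator_of_notMem (show y ∉ ball x ε from fun h' => h (mem_ball_comm.1 h'))]
  · intro x y h
    exact Set.indicator_of_notMem (show x ∉ ball y ε from h) _

lemma invariant_compare {d : ℕ} (μ ν : Measure (Ed d)) [IsFiniteMeasure μ] [IsFiniteMeasure ν]
    (hμS : ∀ᵐ x ∂μ, x ∈ sphereSet d) (hνS : ∀ᵐ x ∂ν, x ∈ sphereSet d)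
    (hμ : ∀ g : Ed d ≃ₗᵢ[ℝ] Ed d, μ.map g = μ) (hν : ∀ g : Ed d ≃ₗᵢ[ℝ] Ed d, ν.map g = ν)
    (f : Ed d → ℝ) (hf : Continuous f) :
    μ Set.univ * ∫⁻ y, ENNReal.ofReal (f y) ∂ν ≤ ν Set.univ * ∫⁻ y, ENNReal.ofReal (f y) ∂μ := by
  by_cases hμ0 : μ = 0
  · simp [hμ0]
  -- measure of balls is constant
  have hball : ∀ (ρ : Measure (Ed d)), (∀ g : Ed d ≃ₗᵢ[ℝ] Ed d, ρ.map g = ρ) → ∀ ε : ℝ,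
      ∀ x ∈ sphereSet d, ∀ y ∈ sphereSet d, ρ (ball x ε) = ρ (ball y ε) := by
    intro ρ hρ ε x hx y hy
    obtain ⟨g, rfl⟩ := exists_isometry hx hy
    conv_rhs => rw [← hρ g]
    rw [Measure.map_apply g.continuous.measurable measurableSet_ball]
    congr 1
    ext z; simp
  obtain ⟨e, he⟩ : (sphereSet d).Nonempty := by
    by_contra h
    rw [Set.not_nonempty_iff_eq_empty] at h
    simp only [h, Set.mem_empty_iff_false, eventually_false_iff_eq_bot, ae_eq_bot] at hμS
    exact hμ0 hμS
  have hFm : Measurable (fun y => ENNReal.ofReal (f y)) := hf.measurable.ennreal_ofReal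
  refine ENNReal.le_of_forall_pos_le_add ?_
  intro η hη _
  set A := μ Set.univ * ν Set.univ with hA
  have hAt : A ≠ ∞ := ENNReal.mul_ne_top (measure_ne_top _ _) (measure_ne_top _ _)
  -- choose δ
  obtain ⟨δ, hδ, hδA⟩ : ∃ δ : ℝ, 0 < δ ∧ ENNReal.ofReal δ * A ≤ η := by
    refine ⟨η / (A.toReal + 1), by positivity, ?_⟩
    rw [← ENNReal.ofReal_toReal hAt, ← ENNReal.ofReal_mul (by positivity)]
    rw [← ENNReal.ofReal_coe_nnreal]
    apply ENNReal.ofReal_le_ofReal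
    rw [ENNReal.toReal_ofReal (by positivity)]
    rw [div_mul_eq_mul_div, div_le_iff₀ (by positivity)]
    have : (0:ℝ) < η := by exact_mod_cast hη
    nlinarith
  have huc := (isCompact_sphereSet d).uniformContinuousOn_of_continuous hf.continuousOn
  rw [Metric.uniformContinuousOn_iff] at huc
  obtain ⟨ε, hε, hfε⟩ := huc δ hδ
  set s := μ (ball e ε) with hs
  set n := ν (ball e ε) with hn
  have hs0 : s ≠ 0 := by
    intro h0
    apply hμ0
    obtain ⟨t, htS, ht⟩ := (isCompact_sphereSet d).elim_nhds_subcover (fun x => ball x ε)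
      (fun x _ => ball_mem_nhds x hε)
    have h1 : μ (sphereSet d) = 0 := by
      refine measure_mono_null ht ((measure_biUnion_null_iff t.countable_toSet).2 ?_)
      intro x hx
      rw [hball μ hμ ε x (htS x hx) e he, ← hs, h0]
    have h2 : μ (sphereSet d)ᶜ = 0 := hμS
    rw [← Measure.measure_univ_eq_zero, ← Set.union_compl_self (sphereSet d)]
    exact measure_union_null h1 h2
  have hst : s ≠ ∞ := measure_ne_top _ _
  obtain ⟨K, hKm, hKx', hKy', hK0⟩ := exists_kernel (X := Ed d) ε
  have hKx : ∀ y ∈ sphereSet d, ∫⁻ x, K x y ∂μ = s := fun y hy => by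
    rw [hKx', hball μ hμ ε y hy e he]
  have hKy : ∀ x ∈ sphereSet d, ∫⁻ y, K x y ∂ν = n := fun y hy => by
    rw [hKy', hball ν hν ε y hy e he]
  have hK1 : ∀ y, Measurable (fun x => K x y) := fun y =>
    hKm.comp (measurable_id.prodMk measurable_const)
  have hK2 : ∀ x, Measurable (fun y => K x y) := fun x =>
    hKm.comp (measurable_const.prodMk measurable_id)
  have key : ∀ F : Ed d → ℝ≥0∞, Measurable F →
      ∫⁻ y, ∫⁻ x, K x y * F y ∂μ ∂ν = s * ∫⁻ y, F y ∂ν := by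
    intro F hF
    rw [← lintegral_const_mul _ hF]
    refine lintegral_congr_ae ?_
    filter_upwards [hνS] with y hy
    rw [lintegral_mul_const _ (hK1 y), hKx y hy]
  have key2 : ∀ F : Ed d → ℝ≥0∞, Measurable F →
      ∫⁻ y, ∫⁻ x, K x y * F x ∂μ ∂ν = n * ∫⁻ x, F x ∂μ := by
    intro F hF
    rw [lintegral_lintegral_swap, ← lintegral_const_mul _ hF]
    · refine lintegral_congr_ae ?_
      filter_upwards [hμS] with y hy
      rw [lintegral_mul_const _ (hK2 y), hKy y hy]
    · exact ((hKm.comp measurable_swap).mul (hF.comp measurable_snd)).aemeasurable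
  have hone : s * ν Set.univ = n * μ Set.univ := by
    have h1 := key (fun _ => 1) measurable_const
    have h2 := key2 (fun _ => 1) measurable_const
    simp only [lintegral_const, one_mul] at h1 h2
    rw [← h1, ← h2]
  have hle : s * ∫⁻ y, ENNReal.ofReal (f y) ∂ν ≤
      n * ∫⁻ y, ENNReal.ofReal (f y) ∂μ + n * (ENNReal.ofReal δ * μ Set.univ) := by
    rw [← key _ hFm, ← mul_add]
    have h3 : ∫⁻ y, ENNReal.ofReal (f y) ∂μ + ENNReal.ofReal δ * μ Set.univ =
        ∫⁻ y, (ENNReal.ofReal (f y) + ENNReal.ofReal δ) ∂μ := by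
      rw [lintegral_add_right _ measurable_const, lintegral_const]
    rw [h3, ← key2 _ (hFm.add_const _)]
    refine lintegral_mono_ae ?_
    filter_upwards [hνS] with y hy
    refine lintegral_mono_ae ?_
    filter_upwards [hμS] with x hx
    by_cases hxy : dist x y < ε
    · gcongr
      refine le_trans (ENNReal.ofReal_le_ofReal ?_) ENNReal.ofReal_add_le
      have := hfε x hx y hy hxy
      rw [Real.dist_eq, abs_lt] at this
      linarith [this.1]
    · simp [hK0 x y hxy]
  have hfin : s * (μ Set.univ * ∫⁻ y, ENNReal.ofReal (f y) ∂ν) ≤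
      s * (ν Set.univ * ∫⁻ y, ENNReal.ofReal (f y) ∂μ + ENNReal.ofReal δ * A) := by
    calc s * (μ Set.univ * ∫⁻ y, ENNReal.ofReal (f y) ∂ν)
        = μ Set.univ * (s * ∫⁻ y, ENNReal.ofReal (f y) ∂ν) := by ring
      _ ≤ μ Set.univ * (n * ∫⁻ y, ENNReal.ofReal (f y) ∂μ +
            n * (ENNReal.ofReal δ * μ Set.univ)) := by gcongr
      _ = (n * μ Set.univ) * (∫⁻ y, ENNReal.ofReal (f y) ∂μ + ENNReal.ofReal δ * μ Set.univ) := by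
            ring
      _ = _ := by rw [← hone, hA]; ring
  refine ((ENNReal.mul_le_mul_iff_right hs0 hst).1 hfin).trans ?_
  gcongr

lemma ae_mem_sphere (d : ℕ) : ∀ᵐ x ∂sphereMeasure d, x ∈ sphereSet d :=
  ae_restrict_mem (measurableSet_sphereSet d)

lemma ae_mem_sub (d : ℕ) (x : Ed d) :
    ∀ᵐ y ∂subSphere d x, y ∈ sphereSet d ∩ {y | (inner ℝ x y : ℝ) = 0} :=
  ae_restrict_mem (isClosed_sub d x).measurableSet

lemma subSphere_univ {d : ℕ} {x e : Ed d} (hx : x ∈ sphereSet d) (he : e ∈ sphereSet d) :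
    subSphere d x Set.univ = subSphere d e Set.univ := by
  rw [← map_refl_subSphere hx he, Measure.map_apply (reflS d x e).continuous.measurable .univ]
  simp

lemma average_subSphere {d : ℕ} (hd : 3 ≤ d) {e : Ed d} (he : e ∈ sphereSet d)
    (f : Ed d → ℝ) (hf : Continuous f) :
    ∫⁻ x, ∫⁻ y, ENNReal.ofReal (f y) ∂subSphere d x ∂sphereMeasure d ≤
      subSphere d e Set.univ * ∫⁻ y, ENNReal.ofReal (f y) ∂sphereMeasure d := by
  have := sphereMeasure_finite d hd
  have := subSphere_finite d hd e he
  by_cases h0 : sphereMeasure d = 0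
  · simp [h0]
  set μ := sphereMeasure d with hμ
  let ν : Measure (Ed d) := (μ.prod (subSphere d e)).map (fun p => reflS d p.1 e p.2)
  have hνl : ∀ F : Ed d → ℝ≥0∞, Measurable F →
      ∫⁻ y, F y ∂ν = ∫⁻ x, ∫⁻ y, F y ∂subSphere d x ∂μ := by
    intro F hF
    rw [lintegral_map hF (measurable_refl e),
      lintegral_prod (fun p : Ed d × Ed d => F (reflS d p.1 e p.2))
        (hF.comp (measurable_refl e)).aemeasurable]
    refine lintegral_congr_ae ?_
    filter_upwards [ae_mem_sphere d] with x hx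
    rw [← map_refl_subSphere hx he, lintegral_map hF (reflS d x e).continuous.measurable]
  have hνA : ∀ A : Set (Ed d), MeasurableSet A → ν A = ∫⁻ x, subSphere d x A ∂μ := by
    intro A hA
    rw [← lintegral_indicator_one hA, hνl _ (measurable_one.indicator hA)]
    simp only [lintegral_indicator_one hA]
  have hνfin : IsFiniteMeasure ν := inferInstance
  have hνinv : ∀ g : Ed d ≃ₗᵢ[ℝ] Ed d, ν.map g = ν := by
    intro g
    ext A hA
    rw [Measure.map_apply g.continuous.measurable hA,
      hνA _ (g.continuous.measurable hA), hνA _ hA]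
    have h1 : ∀ x, subSphere d x (g ⁻¹' A) = subSphere d (g x) A := by
      intro x
      rw [← map_subSphere, Measure.map_apply g.continuous.measurable hA]
    simp only [h1]
    have h2 := lintegral_map_equiv (μ := μ) (fun x => subSphere d x A)
      g.toHomeomorph.toMeasurableEquiv
    have h3 : μ.map (g.toHomeomorph.toMeasurableEquiv) = μ := map_sphereMeasure g
    rw [h3] at h2
    exact h2.symm
  have hνS : ∀ᵐ x ∂ν, x ∈ sphereSet d := by
    change ν (sphereSet d)ᶜ = 0
    rw [hνA _ (measurableSet_sphereSet d).compl]
    rw [lintegral_eq_zero_of_ae_eq_zero]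
    refine Filter.Eventually.of_forall fun x => ?_
    have := (ae_mem_sub d x).mono fun y hy => hy.1
    exact this
  have hνu : ν Set.univ = μ Set.univ * subSphere d e Set.univ := by
    rw [hνA _ .univ, mul_comm, ← lintegral_const]
    refine lintegral_congr_ae ?_
    filter_upwards [ae_mem_sphere d] with x hx
    exact subSphere_univ hx he
  have key := invariant_compare μ ν (ae_mem_sphere d) hνS map_sphereMeasure hνinv f hf
  rw [hνl _ hf.measurable.ennreal_ofReal, hνu, mul_assoc] at key
  exact (ENNReal.mul_le_mul_iff_right (by simpa using h0) (measure_ne_top _ _)).1 key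

/-! ### Iterated integrals -/

lemma iterInt_nonneg {α : Type*} [MeasurableSpace α] (μ : Measure α) (n : ℕ) :
    ∀ (F : (Fin n → α) → ℝ), (∀ v, 0 ≤ F v) → 0 ≤ iterInt n μ F := by
  induction n with
  | zero => intro F hF; exact hF _
  | succ n ih => intro F hF; exact integral_nonneg fun t => ih _ fun v => hF _

lemma iterInt_const_mul {α : Type*} [MeasurableSpace α] (μ : Measure α) (c : ℝ) (n : ℕ) :
    ∀ (F : (Fin n → α) → ℝ), iterInt n μ (fun v => c * F v) = c * iterInt n μ F := by
  induction n with
  | zero => intro F; rfl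
  | succ n ih =>
    intro F
    simp only [iterInt]
    rw [← integral_const_mul]
    congr 1; ext t; exact ih _

lemma iterInt_continuous {α : Type} [MeasurableSpace α] [TopologicalSpace α]
    [FirstCountableTopology α] [LocallyCompactSpace α] [OpensMeasurableSpace α]
    (μ : Measure α) [IsFiniteMeasure μ] (K : Set α) (hK : IsCompact K) (hμK : μ.restrict K = μ)
    (n : ℕ) : ∀ {X : Type} [TopologicalSpace X] [FirstCountableTopology X]
      [LocallyCompactSpace X] (F : X → (Fin n → α) → ℝ), Continuous (fun p : X × (Fin n → α) =>
        F p.1 p.2) → Continuous (fun x => iterInt n μ (F x)) := by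
  induction n with
  | zero =>
    intro X _ _ _ F hF
    exact hF.comp (continuous_id.prodMk continuous_const)
  | succ n ih =>
    intro X _ _ _ F hF
    simp only [iterInt]
    have h1 : Continuous (fun p : X × α => iterInt n μ (fun v => F p.1 (Fin.cons p.2 v))) := by
      refine ih (X := X × α) (fun p v => F p.1 (Fin.cons p.2 v)) ?_
      have h2 : Continuous (fun q : (X × α) × (Fin n → α) =>
          (q.1.1, (Fin.cons q.1.2 q.2 : Fin (n + 1) → α))) := by
        refine Continuous.prodMk (by fun_prop) ?_
        exact Continuous.finCons (by fun_prop) (by fun_prop)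
      exact hF.comp h2
    have h3 := continuous_parametric_integral_of_continuous (μ := μ)
      (f := fun x t => iterInt n μ (fun v => F x (Fin.cons t v))) h1 hK
    rw [hμK] at h3
    exact h3

lemma iterInt_mono {α : Type} [MeasurableSpace α] [TopologicalSpace α] [T2Space α]
    [FirstCountableTopology α] [LocallyCompactSpace α] [OpensMeasurableSpace α]
    (μ : Measure α) [IsFiniteMeasure μ] (K : Set α) (hK : IsCompact K) (hKm : MeasurableSet K)
    (hμK : μ.restrict K = μ)
    (n : ℕ) : ∀ (F G : (Fin n → α) → ℝ), Continuous G → (∀ v, 0 ≤ F v) →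
      (∀ v, (∀ i, v i ∈ K) → F v ≤ G v) → iterInt n μ F ≤ iterInt n μ G := by
  induction n with
  | zero => intro F G _ _ h; exact h _ fun i => i.elim0
  | succ n ih =>
    intro F G hG hF h
    have hae : ∀ᵐ t ∂μ, t ∈ K := by rw [← hμK]; exact ae_restrict_mem hKm
    have hcons : Continuous (fun p : α × (Fin n → α) => (Fin.cons p.1 p.2 : Fin (n + 1) → α)) :=
      Continuous.finCons (by fun_prop) (by fun_prop)
    have hc := iterInt_continuous μ K hK hμK n (fun (t : α) v => G (Fin.cons t v)) (hG.comp hcons)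
    refine integral_mono_of_nonneg (Filter.Eventually.of_forall fun t =>
      iterInt_nonneg μ n _ fun v => hF _) ?_ ?_
    · have := hc.continuousOn.integrableOn_compact (μ := μ) hK
      rw [IntegrableOn, hμK] at this
      exact this
    · filter_upwards [hae] with t ht
      refine ih _ _ (hG.comp (Continuous.finCons continuous_const continuous_id)) (fun v => hF _) ?_
      intro v hv
      refine h _ fun i => ?_
      refine Fin.cases ?_ (fun j => ?_) i
      · exact ht
      · exact hv j

lemma iterInt_map {α β : Type*} [MeasurableSpace α] [MeasurableSpace β] (μ : Measure α)
    (g : α ≃ᵐ β) (n : ℕ) : ∀ (F : (Fin n → β) → ℝ),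
      iterInt n (μ.map g) F = iterInt n μ (fun v => F (fun i => g (v i))) := by
  induction n with
  | zero => intro F; simp only [iterInt]; congr 1; ext i; exact i.elim0
  | succ n ih =>
    intro F
    simp only [iterInt]
    rw [integral_map_equiv]
    congr 1; ext t
    rw [ih]
    congr 1; ext v
    congr 1; ext i
    refine Fin.cases ?_ (fun j => ?_) i <;> simp

/-! ### The determinant kernel -/

lemma detCols_sq {d : ℕ} (v : Fin (d - 1) → Ed d) (x : Ed d) :
    detCols d v x ^ 2 = Matrix.det (Matrix.of (fun (j k : Fin d) =>
      (inner ℝ (if h : (j : ℕ) < d - 1 then v ⟨(j : ℕ), h⟩ else x)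
        (if h : (k : ℕ) < d - 1 then v ⟨(k : ℕ), h⟩ else x) : ℝ))) := by
  rw [detCols, sq]
  nth_rewrite 1 [← Matrix.det_transpose]
  rw [← Matrix.det_mul]
  congr 1
  ext j k
  rw [Matrix.mul_apply, Matrix.of_apply, PiLp.inner_apply]
  refine Finset.sum_congr rfl fun i _ => ?_
  simp only [Matrix.transpose_apply, Matrix.of_apply, RCLike.inner_apply, conj_trivial]
  split_ifs <;> ring

lemma detCols_sq_isometry {d : ℕ} (g : Ed d ≃ₗᵢ[ℝ] Ed d) (v : Fin (d - 1) → Ed d) (x : Ed d) :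
    detCols d (fun i => g (v i)) (g x) ^ 2 = detCols d v x ^ 2 := by
  rw [detCols_sq, detCols_sq]
  congr 1
  ext j k
  simp only [Matrix.of_apply]
  split_ifs <;> simp

lemma continuous_detCols {d : ℕ} (x : Ed d) :
    Continuous (fun v : Fin (d - 1) → Ed d => detCols d v x) := by
  unfold detCols
  refine Continuous.matrix_det ?_
  refine continuous_matrix fun i j => ?_
  simp only [Matrix.of_apply]
  split_ifs <;> fun_prop

/-- The inner integral. -/
def Jint (n : ℕ) (x t : Ed (n + 2)) : ℝ :=
  iterInt n (subSphere (n + 2) x)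
    (fun v => detCols (n + 2) (Fin.cons t v : Fin (n + 1) → Ed (n + 2)) x ^ 2)

lemma Jint_isometry {n : ℕ} (g : Ed (n + 2) ≃ₗᵢ[ℝ] Ed (n + 2)) (x t : Ed (n + 2)) :
    Jint n (g x) (g t) = Jint n x t := by
  unfold Jint
  rw [← map_subSphere]
  have h := iterInt_map (subSphere (n + 2) x) g.toHomeomorph.toMeasurableEquiv n
    (fun v => detCols (n + 2) (Fin.cons (g t) v : Fin (n + 1) → Ed (n + 2)) (g x) ^ 2)
  refine Eq.trans h ?_
  congr 1; ext v
  rw [← detCols_sq_isometry g _ x]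
  congr 2
  ext1 i
  refine Fin.cases ?_ (fun j => ?_) i
  · rfl
  · rfl

lemma Jint_const {n : ℕ} {x t e s : Ed (n + 2)} (hx : x ∈ sphereSet (n + 2))
    (ht : t ∈ sphereSet (n + 2)) (hxt : inner ℝ x t = 0)
    (he : e ∈ sphereSet (n + 2)) (hs : s ∈ sphereSet (n + 2)) (hes : inner ℝ e s = 0) :
    Jint n x t = Jint n e s := by
  obtain ⟨g, rfl⟩ := exists_isometry hx he
  rw [← Jint_isometry g x t]
  have hgt : ‖g t‖ = ‖s‖ := by
    rw [g.norm_map, mem_sphereSet.1 ht, mem_sphereSet.1 hs]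
  have h1 : (ℝ ∙ (g t - s))ᗮ.reflection (g t) = s := Submodule.reflection_sub hgt
  have h2 : (ℝ ∙ (g t - s))ᗮ.reflection (g x) = g x := by
    apply Submodule.reflection_mem_subspace_eq_self
    rw [Submodule.mem_orthogonal_singleton_iff_inner_left, inner_sub_right, hes, g.inner_map_map,
      hxt, sub_zero]
  have h3 := Jint_isometry ((ℝ ∙ (g t - s))ᗮ.reflection) (g x) (g t)
  rw [h1, h2] at h3
  exact h3.symm

lemma Jint_nonneg {n : ℕ} (x t : Ed (n + 2)) : 0 ≤ Jint n x t :=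
  iterInt_nonneg _ _ _ fun _ => sq_nonneg _

lemma integrable_subSphere {d : ℕ} (hd : 3 ≤ d) {x : Ed d} (hx : x ∈ sphereSet d)
    {f : Ed d → ℝ} (hf : Continuous f) : Integrable f (subSphere d x) := by
  have := subSphere_finite d hd x hx
  have h := hf.continuousOn.integrableOn_compact (μ := subSphere d x) (isCompact_sub d x)
  rw [IntegrableOn, subSphere, Measure.restrict_restrict (isClosed_sub d x).measurableSet,
    Set.inter_self] at h
  exact h

lemma integrable_sphereMeasure {d : ℕ} (hd : 3 ≤ d)
    {f : Ed d → ℝ} (hf : Continuous f) : Integrable f (sphereMeasure d) := by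
  have := sphereMeasure_finite d hd
  have h := hf.continuousOn.integrableOn_compact (μ := sphereMeasure d) (isCompact_sphereSet d)
  rw [IntegrableOn, sphereMeasure, Measure.restrict_restrict (measurableSet_sphereSet d),
    Set.inter_self] at h
  exact h

lemma QInt_one {n : ℕ} {e s : Ed (n + 2)} (he : e ∈ sphereSet (n + 2))
    (hs : s ∈ sphereSet (n + 2)) (hes : inner ℝ e s = 0) :
    QInt (n + 2) (fun _ _ => 1) e = Jint n e s * (subSphere (n + 2) e).real Set.univ := by
  have h1 : QInt (n + 2) (fun _ _ => 1) e = ∫ t, Jint n e t ∂subSphere (n + 2) e := by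
    unfold QInt Jint
    simp only [Finset.prod_const_one, mul_one]
    rfl
  rw [h1]
  have h2 : ∫ t, Jint n e t ∂subSphere (n + 2) e = ∫ t, Jint n e s ∂subSphere (n + 2) e := by
    refine integral_congr_ae ?_
    filter_upwards [ae_mem_sub (n + 2) e] with t ht
    exact Jint_const he ht.1 ht.2 he hs hes
  rw [h2, integral_const, smul_eq_mul, mul_comm]

lemma QInt_nonneg {d : ℕ} (g : Fin (d - 1) → Ed d → ℝ) (hg : ∀ i x, 0 ≤ g i x) (x : Ed d) :
    0 ≤ QInt d g x :=
  iterInt_nonneg _ _ _ fun _ => mul_nonneg (sq_nonneg _) (Finset.prod_nonneg fun _ _ => hg _ _)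

lemma abs_le_supNorm {d : ℕ} {ψ : Ed d → ℝ} (hbd : ∃ M : ℝ, ∀ x : Ed d, |ψ x| ≤ M)
    {x : Ed d} (hx : x ∈ sphereSet d) : |ψ x| ≤ supNorm d ψ := by
  obtain ⟨M, hM⟩ := hbd
  refine le_csSup ⟨M, ?_⟩ ⟨x, hx, rfl⟩
  rintro _ ⟨y, _, rfl⟩
  exact hM y

lemma prod_bound {n k : ℕ} (hk2 : 2 ≤ k) (hkd : k ≤ n + 1) {M : ℝ}
    (a : Fin (n + 1) → ℝ) (ha : ∀ i, 0 ≤ a i) (haM : ∀ i, a i ≤ M) :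
    ∏ i : Fin (n + 1), (if (i : ℕ) < k then a i else 1) ≤ M ^ (k - 1) * a 0 := by
  have hM : 0 ≤ M := (ha 0).trans (haM 0)
  rw [Fin.prod_univ_succ]
  have h0 : ((0 : Fin (n + 1)) : ℕ) < k := by simp; omega
  rw [if_pos h0, mul_comm]
  refine mul_le_mul_of_nonneg_right ?_ (ha 0)
  calc ∏ i : Fin n, (if ((i.succ : Fin (n + 1)) : ℕ) < k then a i.succ else 1)
      ≤ ∏ i : Fin n, (if (i : ℕ) < k - 1 then M else 1) := by
        refine Finset.prod_le_prod (fun i _ => ?_) (fun i _ => ?_)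
        · split_ifs
          · exact ha _
          · exact zero_le_one
        · have : ((i.succ : Fin (n + 1)) : ℕ) < k ↔ (i : ℕ) < k - 1 := by
            rw [Fin.val_succ]; omega
          simp only [this]
          split_ifs
          · exact haM _
          · exact le_rfl
    _ = M ^ (k - 1) := by
        rw [Fin.prod_univ_eq_prod_range (fun i => if i < k - 1 then M else 1) n,
          Finset.prod_ite, Finset.prod_const, Finset.prod_const_one, mul_one]
        congr 1
        have : (Finset.range n).filter (fun i => i < k - 1) = Finset.range (k - 1) := by
          ext i; simp; omega
        rw [this, Finset.card_range]

lemma QInt_bound {n : ℕ} (hn : 1 ≤ n) (ψ : Ed (n + 2) → ℝ) (hψ : Continuous ψ)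
    (hbd : ∃ M : ℝ, ∀ x, |ψ x| ≤ M) (k : ℕ) (hk2 : 2 ≤ k) (hkd : k ≤ n + 1)
    {e s : Ed (n + 2)} (he : e ∈ sphereSet (n + 2))
    (hs : s ∈ sphereSet (n + 2)) (hes : inner ℝ e s = 0) {x : Ed (n + 2)}
    (hx : x ∈ sphereSet (n + 2)) :
    QInt (n + 2) (fun i => if (i : ℕ) < k then (fun x => |ψ x|) else fun _ => 1) x ≤
      supNorm (n + 2) ψ ^ (k - 1) * Jint n e s * ∫ t, |ψ t| ∂subSphere (n + 2) x := by
  have := subSphere_finite (n + 2) (by omega) x hx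
  set M := supNorm (n + 2) ψ with hM
  have h1 : QInt (n + 2) (fun i => if (i : ℕ) < k then (fun x => |ψ x|) else fun _ => 1) x ≤
      iterInt (n + 1) (subSphere (n + 2) x)
        (fun v => (M ^ (k - 1) * |ψ (v 0)|) * detCols (n + 2) v x ^ 2) := by
    unfold QInt
    refine iterInt_mono _ _ (isCompact_sub (n + 2) x) (isClosed_sub (n + 2) x).measurableSet ?_
      (n + 1) _ _ ?_ ?_ ?_
    · rw [subSphere, Measure.restrict_restrict (isClosed_sub (n + 2) x).measurableSet,
        Set.inter_self]
    · have hc := continuous_detCols (d := n + 2) x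
      have hc2 : Continuous (fun v : Fin (n + 1) → Ed (n + 2) => |ψ (v 0)|) :=
        (hψ.comp (continuous_apply 0)).abs
      exact (continuous_const.mul hc2).mul (hc.pow 2)
    · intro v
      refine mul_nonneg (sq_nonneg _) (Finset.prod_nonneg fun i _ => ?_)
      beta_reduce
      split_ifs
      · exact abs_nonneg _
      · exact zero_le_one
    · intro v hv
      rw [mul_comm]
      refine mul_le_mul_of_nonneg_right ?_ (sq_nonneg _)
      have := prod_bound (n := n) hk2 hkd (M := M) (fun i => |ψ (v i)|) (fun i => abs_nonneg _)
        (fun i => abs_le_supNorm hbd (hv i).1)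
      refine le_trans (le_of_eq ?_) this
      refine Finset.prod_congr rfl fun i _ => ?_
      beta_reduce
      split_ifs <;> rfl
  refine h1.trans (le_of_eq ?_)
  have h2 : iterInt (n + 1) (subSphere (n + 2) x)
        (fun v => (M ^ (k - 1) * |ψ (v 0)|) * detCols (n + 2) v x ^ 2) =
      ∫ t, (M ^ (k - 1) * |ψ t|) * Jint n x t ∂subSphere (n + 2) x := by
    simp only [iterInt, Fin.cons_zero, iterInt_const_mul]
    rfl
  rw [h2, ← integral_const_mul]
  refine integral_congr_ae ?_
  filter_upwards [ae_mem_sub (n + 2) x] with t ht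
  rw [Jint_const hx ht.1 ht.2 he hs hes]
  ring

lemma cauchy_subSphere {d : ℕ} (hd : 3 ≤ d) {x : Ed d} (hx : x ∈ sphereSet d)
    {ψ : Ed d → ℝ} (hψ : Continuous ψ) (hσ : 0 < (subSphere d x).real Set.univ) :
    (∫ t, |ψ t| ∂subSphere d x) ^ 2 ≤
      (subSphere d x).real Set.univ * ∫ t, ψ t ^ 2 ∂subSphere d x := by
  have := subSphere_finite d hd x hx
  set σ := (subSphere d x).real Set.univ
  set I := ∫ t, |ψ t| ∂subSphere d x with hI
  have h0 : 0 ≤ ∫ t, (ψ t ^ 2 - (2 * (I / σ)) * |ψ t| + (I / σ) ^ 2) ∂subSphere d x := by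
    refine integral_nonneg fun t => ?_
    have : 0 ≤ (|ψ t| - I / σ) ^ 2 := sq_nonneg _
    simp only [Pi.zero_apply]
    nlinarith [sq_abs (ψ t)]
  have i1 : Integrable (fun t => ψ t ^ 2) (subSphere d x) :=
    integrable_subSphere hd hx (hψ.pow 2)
  have i2 : Integrable (fun t => (2 * (I / σ)) * |ψ t|) (subSphere d x) :=
    integrable_subSphere hd hx (continuous_const.mul hψ.abs)
  have i12 : Integrable (fun t => ψ t ^ 2 - (2 * (I / σ)) * |ψ t|) (subSphere d x) := i1.sub i2
  rw [integral_add i12 (integrable_const _), integral_sub i1 i2, integral_const_mul,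
    integral_const, ← hI, smul_eq_mul] at h0
  change 0 ≤ _ - _ + σ * _ at h0
  have h3 : σ * (I / σ) ^ 2 = I ^ 2 / σ := by field_simp
  have h4 : 2 * (I / σ) * I = 2 * (I ^ 2 / σ) := by ring
  rw [h3, h4] at h0
  have h5 : I ^ 2 / σ ≤ ∫ t, ψ t ^ 2 ∂subSphere d x := by linarith
  rwa [div_le_iff₀' hσ] at h5


/-- `‖Q(|ψ|[k], 1[d-1-k])‖_2 ≤ ‖ψ‖_∞^{k-1} ‖ψ‖_2` for `2 ≤ k ≤ d-1`. -/
theorem Q_L2_bound (d : ℕ) (hd : 3 ≤ d) (ψ : Ed d → ℝ) (hψ : Continuous ψ)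
    (hbd : ∃ M : ℝ, ∀ x : Ed d, |ψ x| ≤ M) (k : ℕ) (hk2 : 2 ≤ k) (hkd : k ≤ d - 1) :
    L2norm d (Qfun d (fun i => if (i : ℕ) < k then (fun x => |ψ x|) else fun _ => 1)) ≤
      supNorm d ψ ^ (k - 1) * L2norm d ψ := by
  obtain ⟨n, rfl⟩ : ∃ n, d = n + 2 := ⟨d - 2, by omega⟩
  have hn : 1 ≤ n := by omega
  have hkn : k ≤ n + 1 := hkd
  set e : Ed (n + 2) := EuclideanSpace.single (⟨0, by omega⟩ : Fin (n + 2)) 1 with he_def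
  set s : Ed (n + 2) := EuclideanSpace.single (⟨1, by omega⟩ : Fin (n + 2)) 1 with hs_def
  have he : e ∈ sphereSet (n + 2) := by rw [mem_sphereSet, he_def]; simp
  have hs : s ∈ sphereSet (n + 2) := by rw [mem_sphereSet, hs_def]; simp
  have hes : inner ℝ e s = 0 := by
    rw [he_def, hs_def, EuclideanSpace.inner_single_left]
    simp
  set g : Fin (n + 2 - 1) → Ed (n + 2) → ℝ :=
    (fun i => if (i : ℕ) < k then (fun x => |ψ x|) else fun _ => 1) with hg
  have hg0 : ∀ i x, 0 ≤ g i x := by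
    intro i x
    simp only [hg]
    split_ifs
    · exact abs_nonneg _
    · exact zero_le_one
  have hM0 : 0 ≤ supNorm (n + 2) ψ := (abs_nonneg _).trans (abs_le_supNorm hbd he)
  set M := supNorm (n + 2) ψ with hM
  have := sphereMeasure_finite (n + 2) hd
  have := subSphere_finite (n + 2) hd e he
  set σ := (subSphere (n + 2) e).real Set.univ with hσ
  set C := Jint n e s with hC
  have hC0 : 0 ≤ C := Jint_nonneg e s
  have hσ0 : 0 ≤ σ := measureReal_nonneg
  have hcQ : cQ (n + 2) = (C * σ)⁻¹ := by
    rw [cQ, dif_pos (by omega), QInt_one he hs hes]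
  -- pointwise bound
  have hpt : ∀ x ∈ sphereSet (n + 2), Qfun (n + 2) g x ^ 2 ≤
      ((M ^ (k - 1)) ^ 2 * σ⁻¹) * ∫ t, ψ t ^ 2 ∂subSphere (n + 2) x := by
    intro x hx
    have hI0 : 0 ≤ ∫ t, ψ t ^ 2 ∂subSphere (n + 2) x := integral_nonneg fun t => sq_nonneg _
    rw [Qfun, hcQ]
    by_cases hCσ : C * σ = 0
    · rw [hCσ]; simp only [inv_zero, zero_mul]
      rw [zero_pow two_ne_zero]
      positivity
    have hCp : 0 < C := lt_of_le_of_ne hC0 fun h => hCσ (by rw [← h, zero_mul])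
    have hσp : 0 < σ := lt_of_le_of_ne hσ0 fun h => hCσ (by rw [← h, mul_zero])
    have hσx : (subSphere (n + 2) x).real Set.univ = σ := by
      rw [hσ, measureReal_def, measureReal_def, subSphere_univ hx he]
    have h1 := QInt_bound hn ψ hψ hbd k hk2 hkn he hs hes hx
    rw [← hC, ← hM] at h1
    have h2 := cauchy_subSphere hd hx hψ (by rw [hσx]; exact hσp)
    rw [hσx] at h2
    set I := ∫ t, |ψ t| ∂subSphere (n + 2) x
    have h3 : (C * σ)⁻¹ * QInt (n + 2) g x ≤ M ^ (k - 1) * σ⁻¹ * I := by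
      calc (C * σ)⁻¹ * QInt (n + 2) g x ≤ (C * σ)⁻¹ * (M ^ (k - 1) * C * I) := by
            gcongr
        _ = _ := by field_simp
    have h4 : 0 ≤ (C * σ)⁻¹ * QInt (n + 2) g x :=
      mul_nonneg (by positivity) (QInt_nonneg g hg0 x)
    calc ((C * σ)⁻¹ * QInt (n + 2) g x) ^ 2 ≤ (M ^ (k - 1) * σ⁻¹ * I) ^ 2 :=
          pow_le_pow_left₀ h4 h3 2
      _ = (M ^ (k - 1)) ^ 2 * σ⁻¹ ^ 2 * I ^ 2 := by ring
      _ ≤ (M ^ (k - 1)) ^ 2 * σ⁻¹ ^ 2 * (σ * ∫ t, ψ t ^ 2 ∂subSphere (n + 2) x) := by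
          gcongr
      _ = _ := by field_simp
  set B := (M ^ (k - 1)) ^ 2 * σ⁻¹ with hB
  have hB0 : 0 ≤ B := by positivity
  have hint0 : 0 ≤ ∫ y, ψ y ^ 2 ∂sphereMeasure (n + 2) := integral_nonneg fun _ => sq_nonneg _
  have hmain : ∫ x, Qfun (n + 2) g x ^ 2 ∂sphereMeasure (n + 2) ≤
      (M ^ (k - 1)) ^ 2 * ∫ y, ψ y ^ 2 ∂sphereMeasure (n + 2) := by
    have hrhs : 0 ≤ (M ^ (k - 1)) ^ 2 * ∫ y, ψ y ^ 2 ∂sphereMeasure (n + 2) := by positivity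
    rw [← ENNReal.ofReal_le_ofReal_iff hrhs]
    calc ENNReal.ofReal (∫ x, Qfun (n + 2) g x ^ 2 ∂sphereMeasure (n + 2))
        = ‖∫ x, Qfun (n + 2) g x ^ 2 ∂sphereMeasure (n + 2)‖ₑ := by
          rw [Real.enorm_of_nonneg (integral_nonneg fun _ => sq_nonneg _)]
      _ ≤ ∫⁻ x, ‖Qfun (n + 2) g x ^ 2‖ₑ ∂sphereMeasure (n + 2) :=
          enorm_integral_le_lintegral_enorm _
      _ ≤ ∫⁻ x, ENNReal.ofReal B * ∫⁻ y, ENNReal.ofReal (ψ y ^ 2) ∂subSphere (n + 2) x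
            ∂sphereMeasure (n + 2) := by
          refine lintegral_mono_ae ?_
          filter_upwards [ae_mem_sphere (n + 2)] with x hx
          rw [Real.enorm_of_nonneg (sq_nonneg _),
            ← ofReal_integral_eq_lintegral_ofReal (f := fun y => ψ y ^ 2) (integrable_subSphere hd hx (hψ.pow 2))
              (Filter.Eventually.of_forall fun _ => sq_nonneg _), ← ENNReal.ofReal_mul hB0]
          exact ENNReal.ofReal_le_ofReal (hpt x hx)
      _ = ENNReal.ofReal B * ∫⁻ x, ∫⁻ y, ENNReal.ofReal (ψ y ^ 2) ∂subSphere (n + 2) x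
            ∂sphereMeasure (n + 2) := lintegral_const_mul' _ _ ENNReal.ofReal_ne_top
      _ ≤ ENNReal.ofReal B * (subSphere (n + 2) e Set.univ *
            ∫⁻ y, ENNReal.ofReal (ψ y ^ 2) ∂sphereMeasure (n + 2)) := by
          gcongr
          exact average_subSphere hd he (fun y => ψ y ^ 2) (hψ.pow 2)
      _ = ENNReal.ofReal (B * (σ * ∫ y, ψ y ^ 2 ∂sphereMeasure (n + 2))) := by
          rw [ENNReal.ofReal_mul hB0, ENNReal.ofReal_mul hσ0, hσ, ofReal_measureReal,
            ofReal_integral_eq_lintegral_ofReal (f := fun y => ψ y ^ 2) (integrable_sphereMeasure hd (hψ.pow 2))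
              (Filter.Eventually.of_forall fun _ => sq_nonneg _)]
      _ ≤ _ := by
          apply ENNReal.ofReal_le_ofReal
          rw [hB, mul_assoc, ← mul_assoc σ⁻¹]
          have : σ⁻¹ * σ ≤ 1 := inv_mul_le_one
          gcongr
          exact mul_le_of_le_one_left hint0 this
  rw [L2norm, L2norm]
  refine (Real.sqrt_le_sqrt hmain).trans (le_of_eq ?_)
  rw [Real.sqrt_mul (sq_nonneg _), Real.sqrt_sq (by positivity)]

end
end
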